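/- Let L be a symmetric positive semidefinite n×n real matrix and D a strictly positive real number, and let 𝒜 be the 2n×2n real block matrix with blocks (-D·Iₙ, Iₙ; -L, 0). Then every complex eigenvalue λ of 𝒜 satisfies Re(λ) ≤ 0, and moreover Re(λ) < 0 whenever λ ≠ 0. -/

import Mathlib

open scoped ComplexOrder in
theorem eig_nonneg {n : ℕ} (L : Matrix (Fin n) (Fin n) ℝ) (hL : L.PosSemidef)
    (x : Fin n → ℂ) (hx0 : x ≠ 0) (c : ℂ)
    (h2 : (L.map Complex.ofReal).mulVec x = c • x) : 0 ≤ c.re ∧ 0 = c.im := by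
  have hP : (L.map Complex.ofReal).PosSemidef := by
    obtain ⟨B, rfl⟩ : ∃ B : Matrix (Fin n) (Fin n) ℝ, L = B.conjTranspose * B := by
      open scoped MatrixOrder in
      exact CStarAlgebra.nonneg_iff_eq_star_mul_self.mp hL.nonneg
    have : (B.conjTranspose * B).map Complex.ofReal
        = (B.map Complex.ofReal).conjTranspose * (B.map Complex.ofReal) := by
      ext i j
      simp [Matrix.mul_apply]
    rw [this]
    exact Matrix.posSemidef_conjTranspose_mul_self _
  have h4 := hP.dotProduct_mulVec_nonneg x
  rw [h2, dotProduct_smul, smul_eq_mul] at h4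
  have h5 : 0 < star x ⬝ᵥ x := Matrix.dotProduct_star_self_pos_iff.mpr hx0
  have h6 : 0 ≤ c := by
    rw [Complex.le_def] at h4
    rw [Complex.lt_def] at h5
    obtain ⟨h5r, h5i⟩ := h5
    obtain ⟨h4r, h4i⟩ := h4
    simp only [Complex.mul_re, Complex.mul_im, ← h5i, Complex.zero_re, Complex.zero_im,
      mul_zero, sub_zero, zero_add] at h4r h4i h5r
    rw [Complex.le_def]
    refine ⟨nonneg_of_mul_nonneg_left h4r h5r, ?_⟩
    rcases mul_eq_zero.mp h4i.symm with h | h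
    · exact h.symm
    · exact absurd h h5r.ne'
  simpa [Complex.le_def] using h6

theorem stmt_8 {n : ℕ} (L : Matrix (Fin n) (Fin n) ℝ) (hL : L.PosSemidef)
    (D : ℝ) (hD : 0 < D) :
    let 𝒜 : Matrix (Fin n ⊕ Fin n) (Fin n ⊕ Fin n) ℝ :=
      Matrix.fromBlocks ((-D) • 1) 1 (-L) 0
    ∀ lam : ℂ, lam ∈ spectrum ℂ (𝒜.map Complex.ofReal) →
      lam.re ≤ 0 ∧ (lam ≠ 0 → lam.re < 0) := by
  intro 𝒜 lam hlam
  rw [← Matrix.spectrum_toLin', ← Module.End.hasEigenvalue_iff_mem_spectrum] at hlam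
  obtain ⟨w, hw⟩ := hlam.exists_hasEigenvector
  have hw0 := hw.2
  have hwe := hw.apply_eq_smul
  rw [Matrix.toLin'_apply] at hwe
  set x : Fin n → ℂ := fun i => w (Sum.inl i) with hx
  set y : Fin n → ℂ := fun i => w (Sum.inr i) with hy
  have h1 : ∀ i, y i = (lam + D) * x i := by
    intro i
    have := congrFun hwe (Sum.inl i)
    simp [𝒜, Matrix.mulVec, dotProduct, Matrix.one_apply, apply_ite] at this
    simp only [hx, hy]
    linear_combination this
  have h2 : (L.map Complex.ofReal).mulVec x = (-(lam * (lam + D))) • x := by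
    ext i
    have := congrFun hwe (Sum.inr i)
    simp [𝒜, Matrix.mulVec, dotProduct] at this
    simp only [Matrix.mulVec, dotProduct, Matrix.map_apply, Pi.smul_apply, smul_eq_mul]
    have h3 := h1 i
    simp only [hx, hy] at *
    linear_combination -this - lam * h3
  have hx0 : x ≠ 0 := by
    intro h
    apply hw0
    ext (i | i)
    · exact congrFun h i
    · have := h1 i
      rw [h] at this
      simpa using this
  have h6 := eig_nonneg L hL x hx0 _ h2
  obtain ⟨hr, hi⟩ := h6
  simp at hr hi
  have hi' : lam.im * (2 * lam.re + D) = 0 := by linarith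
  rcases mul_eq_zero.mp hi' with h | h
  · rw [h] at hr
    have ha : lam.re ≤ 0 := by
      by_contra hc
      push Not at hc
      nlinarith [mul_pos hc hD, mul_pos hc hc]
    refine ⟨ha, fun hne => lt_of_le_of_ne ha fun h0 => hne (Complex.ext h0 h)⟩
  · constructor
    · linarith
    · intro; linarith
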